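/- Let p be a prime and u ≥ 0 an integer. For each m, let N be a uniformly random linear map F_p^{m+u} → F_p^m. Then for each r ≥ 0, the probability that dim coker(N) = r tends, as m → ∞, to α_{p,u,r} = (∏_{i=r+1}^∞ (1 − p^{−i})) / (p^{r(u+r)} ∏_{i=1}^{r+u} (1 − p^{−i})). -/

import Mathlib

open Filter Topology

/-- The Cohen–Lenstra constant
`α_{p,u,r} = (∏_{i=r+1}^∞ (1 − p^{−i})) / (p^{r(u+r)} ∏_{i=1}^{r+u} (1 − p^{−i}))`. -/
noncomputable def cohenLenstraAlpha (p u r : ℕ) : ℝ :=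
  (∏' i : ℕ, (1 - ((p : ℝ))⁻¹ ^ (r + 1 + i))) /
    ((p : ℝ) ^ (r * (u + r)) * ∏ i ∈ Finset.range (r + u), (1 - ((p : ℝ))⁻¹ ^ (i + 1)))

section

open Module Submodule Set

section SpanCount

variable {K V : Type*} [Field K] [AddCommGroup V] [Module K V]

variable (K V) in
/-- The number of `n`-tuples of vectors of `V` whose span has dimension `k`. -/
noncomputable def spanCount (n k : ℕ) : ℕ :=
  Nat.card {v : Fin n → V // finrank K (span K (range v)) = k}

theorem card_finrank_sup_span_singleton_eq [Finite K] [FiniteDimensional K V]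
    (W : Submodule K V) (k : ℕ) :
    (Nat.card {x : V // finrank K (W ⊔ K ∙ x : Submodule K V) = k} : ℝ) =
      (if finrank K W = k then (Nat.card K : ℝ) ^ k else 0) +
        if finrank K W + 1 = k then (Nat.card K : ℝ) ^ finrank K V - (Nat.card K : ℝ) ^ (k - 1)
        else 0 := by
  classical
  have hV : Finite V := Module.finite_of_finite K
  have key (x : V) : finrank K (W ⊔ K ∙ x : Submodule K V) = k ↔
      if x ∈ W then finrank K W = k else finrank K W + 1 = k := by
    split_ifs with hx
    · rw [sup_eq_left.2 ((span_singleton_le_iff_mem x W).2 hx)]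
    · rw [finrank_sup_span_singleton hx]
  have hW : Nat.card {x // x ∈ W} = Nat.card K ^ finrank K W := natCard_eq_pow_finrank
  have hWc : Nat.card {x // x ∈ W} + Nat.card {x // x ∉ W} = Nat.card K ^ finrank K V := by
    rw [← natCard_eq_pow_finrank (K := K) (V := V), ← Nat.card_sum]
    exact Nat.card_congr (Equiv.sumCompl _)
  rw [hW] at hWc
  rw [Nat.card_congr (Equiv.subtypeEquivRight key)]
  by_cases h₁ : finrank K W = k
  · have h₂ : finrank K W + 1 ≠ k := by omega
    rw [if_pos h₁, if_neg h₂, add_zero]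
    rw [Nat.card_congr (Equiv.subtypeEquivRight (q := fun x => x ∈ W) fun x => by
      by_cases hx : x ∈ W <;> simp [hx, h₁]), hW, h₁]
    push_cast
    rfl
  by_cases h₂ : finrank K W + 1 = k
  · rw [if_neg h₁, if_pos h₂, zero_add]
    rw [Nat.card_congr (Equiv.subtypeEquivRight (q := fun x => x ∉ W) fun x => by
      by_cases hx : x ∈ W <;> simp [hx, h₁, h₂]), ← h₂, Nat.add_sub_cancel, eq_sub_iff_add_eq']
    exact_mod_cast hWc
  · simp [h₁, h₂]

theorem cast_spanCount_eq_sum (n k : ℕ) [Fintype (Fin n → V)] :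
    (spanCount K V n k : ℝ) =
      ∑ v : Fin n → V, if finrank K (span K (range v)) = k then 1 else 0 := by
  classical
  rw [spanCount, Nat.card_eq_fintype_card, Fintype.card_subtype, Finset.sum_boole]

theorem cast_spanCount_succ [Finite K] [FiniteDimensional K V] (n k : ℕ) :
    (spanCount K V (n + 1) k : ℝ) = spanCount K V n k * (Nat.card K : ℝ) ^ k +
      if k = 0 then 0 else spanCount K V n (k - 1) *
        ((Nat.card K : ℝ) ^ finrank K V - (Nat.card K : ℝ) ^ (k - 1)) := by
  classical
  have hV : Finite V := Module.finite_of_finite K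
  have := Fintype.ofFinite V
  have hcons : spanCount K V (n + 1) k =
      ∑ v : Fin n → V, Nat.card
        {x : V // finrank K (span K (range v) ⊔ K ∙ x : Submodule K V) = k} := by
    rw [spanCount, ← Nat.card_sigma]
    refine Nat.card_congr (Equiv.trans (Equiv.subtypeEquiv
      ((Fin.consEquiv fun _ => V).symm.trans (Equiv.prodComm _ _)) fun w => ?_)
      (Equiv.subtypeProdEquivSigmaSubtype fun (v : Fin n → V) (x : V) =>
        finrank K (span K (range v) ⊔ K ∙ x : Submodule K V) = k))
    obtain ⟨⟨x, v⟩, rfl⟩ := (Fin.consEquiv fun _ => V).surjective w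
    change finrank K (span K (range (Fin.cons x v : Fin (n + 1) → V))) = k ↔
      finrank K (span K (range v) ⊔ K ∙ x : Submodule K V) = k
    rw [Fin.range_cons, span_insert, sup_comm]
  rw [hcons]
  push_cast
  simp only [card_finrank_sup_span_singleton_eq, Finset.sum_add_distrib, cast_spanCount_eq_sum,
    Finset.sum_mul, ite_mul, one_mul, zero_mul]
  rcases k with - | k <;> simp

theorem spanCount_eq_zero_of_lt {n k : ℕ} (h : n < k) : spanCount K V n k = 0 := by
  rw [spanCount, Nat.card_eq_zero]
  refine Or.inl ⟨fun v => ?_⟩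
  have := finrank_range_le_card (R := K) v.1
  rw [Set.finrank, v.2, Fintype.card_fin] at this
  omega

theorem spanCount_zero_zero : spanCount K V 0 0 = 1 :=
  Nat.card_eq_one_iff_unique.2
    ⟨inferInstance, ⟨⟨Fin.elim0, by rw [range_eq_empty, span_empty, finrank_bot]⟩⟩⟩

end SpanCount

/-- The finite `q`-Pochhammer product `(x; x)_n`. -/
noncomputable def eulerProd (x : ℝ) (n : ℕ) : ℝ := ∏ i ∈ Finset.range n, (1 - x ^ (i + 1))

theorem eulerProd_succ (x : ℝ) (n : ℕ) :
    eulerProd x (n + 1) = eulerProd x n * (1 - x ^ (n + 1)) :=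
  Finset.prod_range_succ _ _

theorem eulerProd_add (x : ℝ) (a b : ℕ) :
    eulerProd x (a + b) = eulerProd x a * ∏ i ∈ Finset.range b, (1 - x ^ (a + i + 1)) :=
  Finset.prod_range_add _ _ _

theorem eulerProd_ne_zero {x : ℝ} (h₀ : 0 ≤ x) (h₁ : x < 1) (n : ℕ) : eulerProd x n ≠ 0 :=
  Finset.prod_ne_zero_iff.2 fun i _ => sub_ne_zero.2 (pow_lt_one₀ h₀ h₁ i.succ_ne_zero).ne.symm

/-- The probability that `k + b` uniformly random vectors of a space of dimension `k + a` over a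
finite field span a subspace of dimension `k`. -/
theorem spanCount_div_card_eq {K V : Type*} [Field K] [Finite K] [AddCommGroup V] [Module K V]
    [FiniteDimensional K V] {x : ℝ} (hx : x = (Nat.card K : ℝ)⁻¹) {n k a b : ℕ} (hn : n = k + b)
    (hm : finrank K V = k + a) :
    spanCount K V n k * x ^ (finrank K V * n) =
      x ^ (a * b) * eulerProd x (k + a) * eulerProd x (k + b) /
        (eulerProd x a * eulerProd x b * eulerProd x k) := by
  have hq : 1 < (Nat.card K : ℝ) := by exact_mod_cast Finite.one_lt_card
  have hx₀ : 0 < x := hx ▸ inv_pos.2 (by linarith)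
  have hx₁ : x < 1 := hx ▸ inv_lt_one_of_one_lt₀ hq
  have hP := eulerProd_ne_zero hx₀.le hx₁
  have hqx : (Nat.card K : ℝ) = x⁻¹ := by rw [hx, inv_inv]
  induction n generalizing k a b with
  | zero =>
    obtain ⟨rfl, rfl⟩ : k = 0 ∧ b = 0 := by omega
    have := hP a
    simp only [eulerProd] at this
    simp [spanCount_zero_zero, eulerProd, this]
  | succ n ih =>
    rw [cast_spanCount_succ, hqx]
    rcases k with - | k
    · obtain rfl : b = n + 1 := by omega
      have h := ih (k := 0) (a := a) (b := n) (by omega) hm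
      have h₁ := hP a
      have h₂ := hP n
      have h₃ := hP (n + 1)
      simp only [zero_add, show eulerProd x 0 = 1 from rfl, mul_one, pow_zero, if_true,
        add_zero] at h hm ⊢
      rw [hm] at h ⊢
      rw [mul_add, mul_one, pow_add, ← mul_assoc, h]
      field_simp
    · have h := ih (k := k) (a := a + 1) (b := b) (by omega) (by omega)
      have hfirst : (spanCount K V n (k + 1) : ℝ) * x ^ (finrank K V * n) =
          x ^ (a * b) * (1 - x ^ b) * eulerProd x (k + 1 + a) * eulerProd x (k + b) /
            (x ^ a * (eulerProd x a * eulerProd x b * eulerProd x (k + 1))) := by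
        rcases b with - | b
        · simp [spanCount_eq_zero_of_lt (show n < k + 1 by omega)]
        · rw [ih (k := k + 1) (a := a) (b := b) (by omega) hm, eulerProd_succ x b,
            show k + 1 + b = k + (b + 1) by ring]
          have h₁ := hP a
          have h₂ := hP b
          have h₃ := hP (k + 1)
          have h₄ : 1 - x ^ (b + 1) ≠ 0 := (sub_pos.2 (pow_lt_one₀ hx₀.le hx₁ b.succ_ne_zero)).ne'
          field_simp
          ring
      have h₀ : 1 - x ^ (a + 1) ≠ 0 := (sub_pos.2 (pow_lt_one₀ hx₀.le hx₁ a.succ_ne_zero)).ne'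
      have h₁ := hP a
      have h₂ := hP b
      have h₃ := hP k
      have h₄ : 1 - x ^ (k + 1) ≠ 0 := (sub_pos.2 (pow_lt_one₀ hx₀.le hx₁ k.succ_ne_zero)).ne'
      have hsplit : ∀ c d : ℝ, (c * x⁻¹ ^ (k + 1) + d * (x⁻¹ ^ finrank K V - x⁻¹ ^ k)) *
          x ^ (finrank K V * (n + 1)) = c * x ^ (finrank K V * n) * x ^ a +
            d * x ^ (finrank K V * n) * (1 - x ^ (a + 1)) := by
        intro c d
        rw [mul_add, mul_one, pow_add, hm]
        simp only [inv_pow]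
        field_simp
        ring
      rw [if_neg k.succ_ne_zero, Nat.add_sub_cancel, hsplit, hfirst, h,
        show k + (a + 1) = k + 1 + a by ring, show k + 1 + b = k + b + 1 by ring,
        eulerProd_succ x k, eulerProd_succ x a, eulerProd_succ x (k + b)]
      field_simp
      ring

theorem natCard_linearMap_finrank_coker_eq (K : Type*) [Field K] (n k r : ℕ) :
    Nat.card {N : (Fin n → K) →ₗ[K] (Fin (k + r) → K) //
      finrank K ((Fin (k + r) → K) ⧸ LinearMap.range N) = r} =
      spanCount K (Fin (k + r) → K) n k := by
  refine Nat.card_congr (Equiv.subtypeEquiv ((Pi.basisFun K (Fin n)).constr K).toEquiv.symm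
    fun N => ?_)
  obtain ⟨v, rfl⟩ := ((Pi.basisFun K (Fin n)).constr K).surjective N
  have h := (LinearMap.range ((Pi.basisFun K (Fin n)).constr K v)).finrank_quotient_add_finrank
  rw [Basis.constr_range, finrank_fin_fun] at h
  change _ ↔ finrank K (span K (range (((Pi.basisFun K (Fin n)).constr K).symm
    ((Pi.basisFun K (Fin n)).constr K v)))) = k
  rw [LinearEquiv.symm_apply_apply, Basis.constr_range]
  omega

theorem tendsto_prod_one_sub_pow {x : ℝ} (h₀ : 0 ≤ x) (h₁ : x < 1) (r : ℕ) :
    Tendsto (fun k : ℕ => ∏ i ∈ Finset.range k, (1 - x ^ (r + 1 + i))) atTop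
      (𝓝 (∏' i : ℕ, (1 - x ^ (r + 1 + i)))) := by
  have hs : Summable fun i : ℕ => -x ^ (r + 1 + i) := by
    simp only [pow_add x (r + 1)]
    exact ((summable_geometric_of_lt_one h₀ h₁).mul_left _).neg
  simpa only [sub_eq_add_neg] using
    (Real.multipliable_one_add_of_summable hs).hasProd.tendsto_prod_nat

theorem tendsto_prod_one_sub_pow_add {x : ℝ} (h₀ : 0 ≤ x) (h₁ : x < 1) (b : ℕ) :
    Tendsto (fun k : ℕ => ∏ i ∈ Finset.range b, (1 - x ^ (k + i + 1))) atTop (𝓝 1) := by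
  have h (i : ℕ) : Tendsto (fun k : ℕ => 1 - x ^ (k + i + 1)) atTop (𝓝 1) := by
    simpa [add_assoc] using
      ((tendsto_add_atTop_iff_nat (i + 1)).2
        (tendsto_pow_atTop_nhds_zero_of_lt_one h₀ h₁)).const_sub 1
  simpa using tendsto_finsetProd (Finset.range b) fun i _ => h i

end

/-- For a uniformly random linear map `N : 𝔽_p^{m+u} → 𝔽_p^m`, the probability that
`dim coker N = r` tends to `α_{p,u,r}` as `m → ∞`. -/
theorem prob_corank_tendsto_cohenLenstraAlpha (p : ℕ) (hp : p.Prime) (u r : ℕ) :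
    Tendsto (fun m : ℕ =>
      (Nat.card {N : (Fin (m + u) → ZMod p) →ₗ[ZMod p] (Fin m → ZMod p) //
          Module.finrank (ZMod p) ((Fin m → ZMod p) ⧸ LinearMap.range N) = r} : ℝ) /
        (Nat.card ((Fin (m + u) → ZMod p) →ₗ[ZMod p] (Fin m → ZMod p)) : ℝ))
      atTop (𝓝 (cohenLenstraAlpha p u r)) := by
  have : Fact p.Prime := ⟨hp⟩
  have hp₁ : (1 : ℝ) < p := by exact_mod_cast hp.one_lt
  obtain ⟨x, hx⟩ : ∃ x : ℝ, x = (p : ℝ)⁻¹ := ⟨_, rfl⟩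
  have hx₀ : 0 < x := hx ▸ inv_pos.2 (by linarith)
  have hx₁ : x < 1 := hx ▸ inv_lt_one_of_one_lt₀ hp₁
  rw [← tendsto_add_atTop_iff_nat r]
  have hlim := ((tendsto_prod_one_sub_pow hx₀.le hx₁ r).mul
    (tendsto_prod_one_sub_pow_add hx₀.le hx₁ (r + u))).mul_const
      (x ^ (r * (u + r)) / eulerProd x (r + u))
  refine Eq.subst (motive := fun y => Tendsto _ atTop (𝓝 y)) ?_ (hlim.congr fun k => ?_)
  · rw [cohenLenstraAlpha, ← hx, eulerProd, mul_one, show (p : ℝ) = x⁻¹ by rw [hx, inv_inv],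
      inv_pow, div_mul_eq_div_div, div_inv_eq_mul, mul_div_assoc]
  · have hcard : (Nat.card ((Fin (k + r + u) → ZMod p) →ₗ[ZMod p] (Fin (k + r) → ZMod p)) : ℝ) =
        (x ^ (Module.finrank (ZMod p) (Fin (k + r) → ZMod p) * (k + r + u)))⁻¹ := by
      rw [Module.natCard_eq_pow_finrank (K := ZMod p), Module.finrank_linearMap, Nat.card_zmod,
        ← inv_pow, hx, inv_inv, Module.finrank_fin_fun, Module.finrank_fin_fun, mul_comm]
      push_cast
      rfl
    rw [natCard_linearMap_finrank_coker_eq, hcard, div_inv_eq_mul,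
      spanCount_div_card_eq (by rw [hx, Nat.card_zmod]) (show k + r + u = k + (r + u) by ring)
        (Module.finrank_fin_fun _), eulerProd_add x k (r + u), add_comm k r, eulerProd_add x r k]
    have h₁ := eulerProd_ne_zero hx₀.le hx₁ r
    have h₂ := eulerProd_ne_zero hx₀.le hx₁ k
    have h₃ := eulerProd_ne_zero hx₀.le hx₁ (r + u)
    simp only [add_right_comm r _ 1, add_comm u r]
    field_simp
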